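/- (Lemma 1, second part: quadratic majorization.) Let φ(t) = max(1 − t, 0) be the hinge loss, K^E the Epanechnikov kernel, and b > 0, and let φ_b(t) = ∫_ℝ φ(t + b v) K^E(v) dv be the convolution-smoothed hinge loss with derivative φ_b′. Then for all u₁, u₂ ∈ ℝ: φ_b(u₁) ≤ φ_b(u₂) + φ_b′(u₂)·(u₁ − u₂) + (3/(8b))·(u₁ − u₂)². -/

import Mathlib

open MeasureTheory

/-- The hinge loss `φ(t) = max(1 − t, 0)`. -/
noncomputable def hinge (t : ℝ) : ℝ := max (1 - t) 0

/-- The Epanechnikov kernel `K^E(u) = (3/4)(1 − u²)` for `|u| ≤ 1`, and `0` otherwise. -/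
noncomputable def epan (u : ℝ) : ℝ := if |u| ≤ 1 then (3 / 4) * (1 - u ^ 2) else 0

/-- The convolution-smoothed hinge loss `φ_b(t) = ∫ φ(t + b v) K(v) dv`. -/
noncomputable def smoothedHinge (K : ℝ → ℝ) (b t : ℝ) : ℝ :=
  ∫ v : ℝ, hinge (t + b * v) * K v

lemma epan_le (u : ℝ) : epan u ≤ 3 / 4 := by
  unfold epan
  split_ifs
  · nlinarith [sq_nonneg u]
  · norm_num

lemma epan_eq_indicator :
    epan = (Set.Icc (-1 : ℝ) 1).indicator fun u => 3 / 4 * (1 - u ^ 2) := by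
  ext u
  simp [epan, Set.indicator_apply, abs_le]

lemma continuous_hinge : Continuous hinge := by
  unfold hinge
  fun_prop

lemma integrable_mul_epan {f : ℝ → ℝ} (hf : Continuous f) :
    Integrable fun v => f v * epan v := by
  have h : (fun v => f v * epan v) =
      (Set.Icc (-1 : ℝ) 1).indicator fun v => f v * (3 / 4 * (1 - v ^ 2)) := by
    ext v
    simp [epan_eq_indicator, Set.indicator_apply]
  rw [h, integrable_indicator_iff measurableSet_Icc]
  exact Continuous.integrableOn_Icc (by fun_prop)

lemma integrable_epan : Integrable epan := by
  simpa using integrable_mul_epan (f := fun _ => 1) continuous_const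

lemma abs_hinge_sub_le (x y : ℝ) : |hinge x - hinge y| ≤ |x - y| := by
  have h := abs_max_sub_max_le_abs (1 - x) (1 - y) 0
  rwa [sub_sub_sub_cancel_left, abs_sub_comm y x] at h

lemma hasDerivAt_hinge_of_lt {t : ℝ} (ht : t < 1) : HasDerivAt hinge (-1) t := by
  refine ((hasDerivAt_id t).const_sub 1).congr_of_eventuallyEq ?_
  filter_upwards [eventually_lt_nhds ht] with x hx
  exact max_eq_left (sub_nonneg.2 hx.le)

lemma hasDerivAt_hinge_of_gt {t : ℝ} (ht : 1 < t) : HasDerivAt hinge 0 t := by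
  refine (hasDerivAt_const t (0 : ℝ)).congr_of_eventuallyEq ?_
  filter_upwards [eventually_gt_nhds ht] with x hx
  exact max_eq_right (sub_nonpos.2 hx.le)

lemma hasDerivAt_smoothedHinge_epan {b : ℝ} (hb : 0 < b) (t : ℝ) :
    HasDerivAt (smoothedHinge epan b) (-∫ v in Set.Iic ((1 - t) / b), epan v) t := by
  have key := hasDerivAt_integral_of_dominated_loc_of_lip (μ := volume)
    (F := fun s v => hinge (s + b * v) * epan v)
    (F' := fun v => -(Set.Iic ((1 - t) / b)).indicator epan v)
    (x₀ := t) (s := Set.univ) (bound := epan) Filter.univ_mem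
    (Filter.Eventually.of_forall fun s =>
      (integrable_mul_epan (continuous_hinge.comp
        (by fun_prop : Continuous fun v => s + b * v))).aestronglyMeasurable)
    (integrable_mul_epan (continuous_hinge.comp
        (by fun_prop : Continuous fun v => t + b * v)))
    (integrable_epan.indicator measurableSet_Iic).neg.aestronglyMeasurable
    (Filter.Eventually.of_forall fun v => ?_) integrable_epan ?_
  · have h := key.2
    rwa [integral_neg, integral_indicator measurableSet_Iic] at h
  · refine (LipschitzWith.of_dist_le_mul fun x y => ?_).lipschitzOnWith
    rw [Real.dist_eq, Real.dist_eq, ← sub_mul, abs_mul, Real.coe_nnabs,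
      mul_comm |epan v|]
    refine mul_le_mul_of_nonneg_right ?_ (abs_nonneg _)
    simpa only [add_sub_add_right_eq_sub] using abs_hinge_sub_le (x + b * v) (y + b * v)
  · filter_upwards [Measure.ae_ne volume ((1 - t) / b)] with v hv
    rcases lt_or_gt_of_ne hv with h | h
    · have h' : t + b * v < 1 := by
        rw [lt_div_iff₀ hb] at h
        linarith
      rw [Set.indicator_of_mem (Set.mem_Iic.2 h.le)]
      simpa using ((hasDerivAt_hinge_of_lt h').comp_add_const t (b * v)).mul_const (epan v)
    · have h' : 1 < t + b * v := by
        rw [div_lt_iff₀ hb] at h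
        linarith
      rw [Set.indicator_of_notMem (by simpa using h)]
      simpa using ((hasDerivAt_hinge_of_gt h').comp_add_const t (b * v)).mul_const (epan v)

lemma setIntegral_Iic_epan_sub_le {x y : ℝ} (hxy : x ≤ y) :
    (∫ v in Set.Iic y, epan v) - ∫ v in Set.Iic x, epan v ≤ 3 / 4 * (y - x) := by
  rw [intervalIntegral.integral_Iic_sub_Iic integrable_epan.integrableOn
    integrable_epan.integrableOn]
  calc ∫ v in x..y, epan v ≤ ∫ _ in x..y, (3 / 4 : ℝ) :=
        intervalIntegral.integral_mono hxy integrable_epan.intervalIntegrable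
          intervalIntegrable_const epan_le
    _ = 3 / 4 * (y - x) := by rw [intervalIntegral.integral_const, smul_eq_mul, mul_comm]

/-- A function whose derivative grows at rate at most `2 * c` is majorized by its tangent
parabolas of leading coefficient `c`. -/
lemma le_tangent_add_sq {f f' : ℝ → ℝ} {c : ℝ} (hf : ∀ t, HasDerivAt f (f' t) t)
    (hf' : ∀ s t, s ≤ t → f' t - f' s ≤ 2 * c * (t - s)) (x y : ℝ) :
    f x ≤ f y + f' y * (x - y) + c * (x - y) ^ 2 := by
  have hg (t : ℝ) : HasDerivAt (fun t => c * (t - y) ^ 2 - f t) (2 * c * (t - y) - f' t) t := by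
    refine ((((hasDerivAt_id t).sub_const y).pow 2).const_mul c).sub (hf t) |>.congr_deriv ?_
    simp
    ring
  rcases lt_trichotomy x y with h | rfl | h
  · obtain ⟨z, ⟨hxz, hzy⟩, hz⟩ := exists_hasDerivAt_eq_slope _ _ h
      (fun t _ => (hg t).continuousAt.continuousWithinAt) (fun t _ => hg t)
    rw [eq_div_iff (by linarith)] at hz
    have := hf' z y hzy.le
    nlinarith [mul_nonneg (sub_nonneg.2 h.le) (sub_nonneg.2 this)]
  · simp
  · obtain ⟨z, ⟨hyz, hzx⟩, hz⟩ := exists_hasDerivAt_eq_slope _ _ h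
      (fun t _ => (hg t).continuousAt.continuousWithinAt) (fun t _ => hg t)
    rw [eq_div_iff (by linarith)] at hz
    have := hf' y z hyz.le
    nlinarith [mul_nonneg (sub_nonneg.2 h.le) (sub_nonneg.2 this)]

/-- Lemma 1 (second part): the Epanechnikov convolution-smoothed hinge loss admits the
quadratic majorization
`φ_b(u₁) ≤ φ_b(u₂) + φ_b′(u₂)(u₁ − u₂) + (3/(8b))(u₁ − u₂)²`. -/
theorem smoothedHinge_epan_quadratic_majorization (b : ℝ) (hb : 0 < b) (u₁ u₂ : ℝ) :
    smoothedHinge epan b u₁ ≤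
      smoothedHinge epan b u₂ + deriv (smoothedHinge epan b) u₂ * (u₁ - u₂) +
        3 / (8 * b) * (u₁ - u₂) ^ 2 := by
  rw [(hasDerivAt_smoothedHinge_epan hb u₂).deriv]
  refine le_tangent_add_sq (hasDerivAt_smoothedHinge_epan hb) (fun s t hst => ?_) u₁ u₂
  have h := setIntegral_Iic_epan_sub_le
    (div_le_div_of_nonneg_right (sub_le_sub_left hst 1) hb.le)
  have e : 3 / 4 * ((1 - s) / b - (1 - t) / b) = 2 * (3 / (8 * b)) * (t - s) := by
    field_simp
    ring
  linarith
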